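/- arXiv:2004.13344 — 2 statements merged into one kernel-verified Lean document; each statement's English description precedes it below -/
import Mathlib

section
/- For fixed probability density functions p and q on a measurable space X, the function D ↦ ∫ p(x)·log(D(x)) dx + ∫ q(x)·log(1 − D(x)) dx over measurable functions D : X → (0,1) is maximized pointwise by D*(x) = p(x)/(p(x)+q(x)); that is, for every x with p(x)+q(x) > 0, the function t ↦ p(x)·log t + q(x)·log(1−t) on (0,1) attains its maximum at t = p(x)/(p(x)+q(x)). -/
open Real

theorem gibbs_aux (a s t : ℝ) (ha : 0 ≤ a) (hs : 0 < s) (ht : 0 < t) :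
    a * Real.log t ≤ a * Real.log (a / s) + (t * s - a) := by
  rcases ha.eq_or_lt with h | h
  · subst h
    simp only [zero_mul, zero_add, sub_zero]
    positivity
  · have h1 := Real.log_le_sub_one_of_pos (show 0 < t / (a / s) by positivity)
    rw [Real.log_div ht.ne' (by positivity)] at h1
    have h2 := mul_le_mul_of_nonneg_left h1 ha
    have h3 : a * (t / (a / s) - 1) = t * s - a := by
      field_simp
    linarith [mul_sub a (Real.log t) (Real.log (a / s))]

/-- Optimal discriminator lemma (pointwise form): for densities `p, q ≥ 0` and a point `x`
with `p x + q x > 0`, the function `t ↦ p x * log t + q x * log (1 - t)` on `(0,1)` is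
maximized at `t = p x / (p x + q x)`. -/
theorem stmt_0 {X : Type*} [MeasurableSpace X] (p q : X → ℝ)
    (hp : ∀ x, 0 ≤ p x) (hq : ∀ x, 0 ≤ q x) (x : X) (hx : 0 < p x + q x) :
    ∀ t ∈ Set.Ioo (0 : ℝ) 1,
      p x * Real.log t + q x * Real.log (1 - t) ≤
        p x * Real.log (p x / (p x + q x)) +
          q x * Real.log (1 - p x / (p x + q x)) := by
  intro t ht
  have h1 := gibbs_aux (p x) (p x + q x) t (hp x) hx ht.1
  have h2 := gibbs_aux (q x) (p x + q x) (1 - t) (hq x) hx (by linarith [ht.2])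
  have h3 : 1 - p x / (p x + q x) = q x / (p x + q x) := by
    field_simp
    ring
  rw [h3]
  linarith
end

section
/- Let ℓ : Z → ℝ be bounded with 0 ≤ ℓ ≤ M on a space Z partitioned into K disjoint measurable sets C₁,…,C_K with probabilities μ(C_i), and let s₁,…,s_n ∈ Z with N_i = #{j : s_j ∈ C_i}. Suppose for every i and every z, s ∈ C_i we have |ℓ(z) − ℓ(s)| ≤ ε. Then |𝔼[ℓ] − (1/n)∑_{j=1}^n ℓ(s_j)| ≤ ε + M·∑_{i=1}^K |N_i/n − μ(C_i)|. -/
open MeasureTheory Finset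
open scoped Classical

/-- Robustness-based generalization bound: if `0 ≤ ℓ ≤ M` is measurable on a space `Z`
partitioned into `K` disjoint sets `C i` covering `Z`, the points `s j` have cell counts
`N i`, and `ℓ` varies by at most `ε` within each cell, then the gap between the expectation
of `ℓ` and its empirical average is at most `ε + M * ∑ i, |N i / n - μ (C i)|`. -/
theorem stmt_7 {Z : Type*} [MeasurableSpace Z] (μ : Measure Z) [IsProbabilityMeasure μ]
    (ℓ : Z → ℝ) (M : ℝ) (hmeas : Measurable ℓ) (hℓ0 : ∀ z, 0 ≤ ℓ z) (hℓM : ∀ z, ℓ z ≤ M)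
    (K n : ℕ) (hn : 0 < n) (C : Fin K → Set Z)
    (hCmeas : ∀ i, MeasurableSet (C i))
    (hdisj : ∀ i j, i ≠ j → Disjoint (C i) (C j))
    (hcover : (⋃ i, C i) = Set.univ)
    (s : Fin n → Z) (N : Fin K → ℕ)
    (hN : ∀ i, N i = (Finset.univ.filter (fun j => s j ∈ C i)).card)
    (ε : ℝ) (hrob : ∀ i, ∀ z ∈ C i, ∀ z' ∈ C i, |ℓ z - ℓ z'| ≤ ε) :
    |(∫ z, ℓ z ∂μ) - (1 / n) * ∑ j, ℓ (s j)| ≤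
      ε + M * ∑ i, |(N i : ℝ) / n - (μ (C i)).toReal| := by
  have hn' : (0 : ℝ) < n := by exact_mod_cast hn
  have hM : 0 ≤ M := (hℓ0 (s ⟨0, hn⟩)).trans (hℓM _)
  have hint : Integrable ℓ μ := by
    refine Integrable.of_bound hmeas.aestronglyMeasurable M (Filter.Eventually.of_forall ?_)
    intro z
    rw [Real.norm_eq_abs, abs_of_nonneg (hℓ0 z)]
    exact hℓM z
  have hex : ∀ i, ∃ a : ℝ, 0 ≤ a ∧ a ≤ M ∧ ∫ z in C i, ℓ z ∂μ = (μ (C i)).toReal * a ∧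
      ∀ z ∈ C i, |ℓ z - a| ≤ ε := by
    intro i
    by_cases hp : μ (C i) = 0
    · have h0 : ∫ z in C i, ℓ z ∂μ = 0 := by
        rw [Measure.restrict_eq_zero.2 hp, integral_zero_measure]
      rcases (C i).eq_empty_or_nonempty with he | ⟨z0, hz0⟩
      · exact ⟨0, le_rfl, hM, by simp [h0], by simp [he]⟩
      · exact ⟨ℓ z0, hℓ0 _, hℓM _, by simp [h0, hp], fun z hz => hrob i z hz z0 hz0⟩
    · have hpp : 0 < (μ (C i)).toReal := ENNReal.toReal_pos hp (measure_ne_top _ _)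
      have hub : ∫ z in C i, ℓ z ∂μ ≤ M * (μ (C i)).toReal := by
        have := norm_setIntegral_le_of_norm_le_const (μ := μ) (s := C i) (f := ℓ) (C := M)
          (measure_lt_top _ _) (fun z _ => by
            rw [Real.norm_eq_abs, abs_of_nonneg (hℓ0 z)]; exact hℓM z)
        exact (le_abs_self _).trans this
      refine ⟨(∫ z in C i, ℓ z ∂μ) / (μ (C i)).toReal, ?_, ?_, ?_, ?_⟩
      · exact div_nonneg (integral_nonneg hℓ0) hpp.le
      · rwa [div_le_iff₀ hpp]
      · field_simp
      · intro z hz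
        have h1 := norm_setIntegral_le_of_norm_le_const (μ := μ) (s := C i)
          (f := fun w => ℓ z - ℓ w) (C := ε)
          (measure_lt_top _ _) (fun w hw => hrob i z hz w hw)
        rw [integral_sub (integrable_const _) hint.integrableOn, setIntegral_const,
          Real.norm_eq_abs, smul_eq_mul] at h1
        change |(μ (C i)).toReal * ℓ z - _| ≤ ε * (μ (C i)).toReal at h1
        have h2 : ℓ z - (∫ z in C i, ℓ z ∂μ) / (μ (C i)).toReal =
            ((μ (C i)).toReal * ℓ z - ∫ z in C i, ℓ z ∂μ) / (μ (C i)).toReal := by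
          field_simp
        rw [h2, abs_div, abs_of_pos hpp, div_le_iff₀ hpp]
        exact h1
  choose a ha0 haM haI haε using hex
  have hI : ∫ z, ℓ z ∂μ = ∑ i, (μ (C i)).toReal * a i := by
    rw [← setIntegral_univ, ← hcover, integral_iUnion_fintype hCmeas
      (fun i j hij => hdisj i j hij) (fun i => hint.integrableOn)]
    exact Finset.sum_congr rfl fun i _ => haI i
  have hcell : ∀ f : Fin n → ℝ, ∑ j, f j =
      ∑ i, ∑ j ∈ Finset.univ.filter (fun j => s j ∈ C i), f j := by
    intro f
    have hz : ∀ z, ∃ i, z ∈ C i := fun z => by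
      have : z ∈ ⋃ i, C i := hcover ▸ Set.mem_univ z
      simpa using this
    choose g hg using hz
    rw [← Finset.sum_fiberwise Finset.univ (fun j => g (s j)) f]
    refine Finset.sum_congr rfl fun i _ => Finset.sum_congr ?_ fun _ _ => rfl
    ext j
    simp only [Finset.mem_filter, Finset.mem_univ, true_and]
    constructor
    · rintro rfl
      exact hg _
    · intro h
      by_contra hne
      exact Set.disjoint_left.1 (hdisj _ _ hne) (hg _) h
  have hNs : ∑ i, (N i : ℝ) = n := by
    have := hcell (fun _ => 1)
    simp only [Finset.sum_const, nsmul_eq_mul, mul_one, Finset.card_univ, Fintype.card_fin] at this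
    rw [this]
    exact Finset.sum_congr rfl fun i _ => by rw [hN i]
  have hS : ∀ i, |(μ (C i)).toReal * a i -
      (1 / n) * ∑ j ∈ Finset.univ.filter (fun j => s j ∈ C i), ℓ (s j)| ≤
      (N i : ℝ) / n * ε + M * |(N i : ℝ) / n - (μ (C i)).toReal| := by
    intro i
    have h1 : |∑ j ∈ Finset.univ.filter (fun j => s j ∈ C i), (ℓ (s j) - a i)| ≤ N i * ε := by
      refine (Finset.abs_sum_le_sum_abs _ _).trans ?_
      rw [hN i, ← nsmul_eq_mul]
      exact Finset.sum_le_card_nsmul _ _ _ fun j hj => haε i _ (Finset.mem_filter.1 hj).2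
    rw [Finset.sum_sub_distrib, Finset.sum_const, ← hN i, nsmul_eq_mul] at h1
    set S := ∑ j ∈ Finset.univ.filter (fun j => s j ∈ C i), ℓ (s j)
    have h2 : (μ (C i)).toReal * a i - (1 / n) * S =
        -((S - N i * a i) / n) - a i * ((N i : ℝ) / n - (μ (C i)).toReal) := by
      field_simp
      ring
    rw [h2]
    refine (abs_sub _ _).trans ?_
    rw [abs_neg, abs_div, abs_of_pos hn', abs_mul, abs_of_nonneg (ha0 i)]
    refine add_le_add ?_ (mul_le_mul_of_nonneg_right (haM i) (abs_nonneg _))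
    rw [div_mul_eq_mul_div]
    exact div_le_div_of_nonneg_right h1 hn'.le
  rw [hI, hcell, Finset.mul_sum, ← Finset.sum_sub_distrib]
  refine (Finset.abs_sum_le_sum_abs _ _).trans ((Finset.sum_le_sum fun i _ => hS i).trans ?_)
  rw [Finset.sum_add_distrib, ← Finset.sum_mul, ← Finset.sum_div, hNs, div_self hn'.ne',
    one_mul, Finset.mul_sum]
end
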